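/- Let {x_k}, {z_k} be sequences in ℝⁿ generated by the unconstrained accelerated mirror descent rule: z_{k+1} = z_k − ((k+1)σs/2)∇f(x_k) and ∇φ*(z_{k+1}) = (1/2)[(k+3)x_{k+1} − (k+1)x_k + (k+1)s∇f(x_k)]. If 0 < s ≤ 1/L, then min_{0 ≤ i ≤ k} ‖∇f(x_i)‖² = o(1/k³) as k → ∞; that is, k³ · min_{0 ≤ i ≤ k} ‖∇f(x_i)‖² → 0. -/

import Mathlib

open Set Filter Topology
open scoped RealInnerProductSpace

/-- The Fenchel conjugate of a function on Euclidean space. -/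
noncomputable def fenchelConj {n : ℕ} (φ : EuclideanSpace ℝ (Fin n) → ℝ)
    (z : EuclideanSpace ℝ (Fin n)) : ℝ :=
  ⨆ x : EuclideanSpace ℝ (Fin n), (⟪z, x⟫ - φ x)

section FirstOrder

variable {E : Type*} [NormedAddCommGroup E] [InnerProductSpace ℝ E] [CompleteSpace E]

/-- The derivative of a differentiable function along a line. -/
theorem HasGradientAt.hasDerivAt_line {f : E → ℝ} {g x d : E} {t : ℝ}
    (hf : HasGradientAt f g (x + t • d)) :
    HasDerivAt (fun r : ℝ => f (x + r • d)) ⟪g, d⟫ t := by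
  have hline : HasDerivAt (fun r : ℝ => x + r • d) d t := by
    simpa using ((hasDerivAt_id t).smul_const d).const_add x
  simpa [Function.comp_def] using hf.hasFDerivAt.comp_hasDerivAt t hline

/-- First-order inequality for a function satisfying a convexity inequality with defect `C`. -/
theorem HasGradientAt.inner_le_of_convex_defect {f : E → ℝ} {g x y : E} {C : ℝ}
    (hf : HasGradientAt f g x)
    (hC : ∀ t : ℝ, 0 < t → t < 1 →
      f (x + t • (y - x)) ≤ (1 - t) * f x + t * f y + t * (1 - t) * C) :
    ⟪g, y - x⟫ ≤ f y - f x + C := by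
  have hd : HasDerivAt (fun r : ℝ => f (x + r • (y - x))) ⟪g, y - x⟫ 0 :=
    HasGradientAt.hasDerivAt_line (by simpa using hf)
  have hlim := hd.tendsto_slope_zero_right
  have hlim' : Tendsto (fun t : ℝ => f y - f x + (1 - t) * C) (𝓝[>] 0) (𝓝 (f y - f x + C)) := by
    have h : Continuous fun t : ℝ => f y - f x + (1 - t) * C := by fun_prop
    simpa using (h.tendsto 0).mono_left nhdsWithin_le_nhds
  refine le_of_tendsto_of_tendsto hlim hlim' ?_
  filter_upwards [Ioo_mem_nhdsGT (zero_lt_one : (0 : ℝ) < 1)] with t ht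
  have h := hC t ht.1 ht.2
  simp only [zero_add, zero_smul, add_zero, smul_eq_mul]
  rw [inv_mul_le_iff₀ ht.1]
  linarith

theorem ConvexOn.add_inner_le_of_hasGradientAt {f : E → ℝ} {g x : E}
    (hconv : ConvexOn ℝ Set.univ f) (hf : HasGradientAt f g x) (y : E) :
    f x + ⟪g, y - x⟫ ≤ f y := by
  have h := hf.inner_le_of_convex_defect (y := y) (C := 0) fun t ht0 ht1 => by
    have h := hconv.2 (mem_univ x) (mem_univ y) (sub_nonneg.2 ht1.le) ht0.le (by ring)
    rw [show x + t • (y - x) = (1 - t) • x + t • y by module]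
    simpa using h
  linarith

/-- The descent lemma for a function with Lipschitz gradient. -/
theorem le_add_inner_add_sq_of_lipschitz_gradient {f : E → ℝ} {f' : E → E} {L : ℝ}
    (hfd : ∀ x, HasGradientAt f (f' x) x) (hfL : ∀ x y, ‖f' x - f' y‖ ≤ L * ‖x - y‖)
    (x y : E) : f y ≤ f x + ⟪f' x, y - x⟫ + L / 2 * ‖y - x‖ ^ 2 := by
  set d := y - x with hd
  have hder : ∀ t : ℝ, HasDerivAt
      (fun r : ℝ => f (x + r • d) - r * ⟪f' x, d⟫ - L / 2 * ‖d‖ ^ 2 * r ^ 2)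
      (⟪f' (x + t • d), d⟫ - ⟪f' x, d⟫ - L * ‖d‖ ^ 2 * t) t := fun t => by
    have h1 := (hfd (x + t • d)).hasDerivAt_line
    have h2 := (hasDerivAt_id t).mul_const ⟪f' x, d⟫
    have h3 := ((hasDerivAt_id t).pow 2).const_mul (L / 2 * ‖d‖ ^ 2)
    refine ((h1.sub h2).sub h3).congr_deriv ?_
    simp
    ring
  have hanti := antitoneOn_of_deriv_nonpos (convex_Icc (0 : ℝ) 1)
    (fun t _ => (hder t).continuousAt.continuousWithinAt)
    (fun t _ => (hder t).differentiableAt.differentiableWithinAt) fun t ht => by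
      rw [interior_Icc] at ht
      rw [(hder t).deriv, ← inner_sub_left]
      have h1 := real_inner_le_norm (f' (x + t • d) - f' x) d
      have h2 := hfL (x + t • d) x
      rw [add_sub_cancel_left, norm_smul, Real.norm_of_nonneg ht.1.le] at h2
      have h3 := mul_le_mul_of_nonneg_right h2 (norm_nonneg d)
      linarith
  have h := hanti (left_mem_Icc.2 zero_le_one) (right_mem_Icc.2 zero_le_one) zero_le_one
  simp only [one_smul, zero_smul, add_zero, hd, add_sub_cancel] at h
  linarith

/-- A convex function with Lipschitz gradient exceeds its tangents by a multiple of the squared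
distance between the gradients. -/
theorem ConvexOn.add_inner_add_sq_le_of_lipschitz_gradient {f : E → ℝ} {f' : E → E} {L s : ℝ}
    (hconv : ConvexOn ℝ Set.univ f) (hfd : ∀ x, HasGradientAt f (f' x) x)
    (hfL : ∀ x y, ‖f' x - f' y‖ ≤ L * ‖x - y‖) (hs : 0 ≤ s) (hsL : L * s ≤ 1) (x y : E) :
    f x + ⟪f' x, y - x⟫ + s / 2 * ‖f' x - f' y‖ ^ 2 ≤ f y := by
  set d := f' y - f' x with hd
  have h1 := le_add_inner_add_sq_of_lipschitz_gradient hfd hfL y (y - s • d)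
  have h2 := hconv.add_inner_le_of_hasGradientAt (hfd x) (y - s • d)
  rw [sub_sub_cancel_left, norm_neg, norm_smul, Real.norm_of_nonneg hs, inner_neg_right,
    inner_smul_right] at h1
  rw [sub_right_comm, inner_sub_right _ (y - x), inner_smul_right] at h2
  have h3 : ⟪f' y, d⟫ - ⟪f' x, d⟫ = ‖d‖ ^ 2 := by
    rw [← inner_sub_left, ← hd, real_inner_self_eq_norm_sq]
  have h4 : L * s * (s * ‖d‖ ^ 2) ≤ 1 * (s * ‖d‖ ^ 2) := by gcongr
  rw [norm_sub_rev, ← hd]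
  linear_combination h1 + h2 + h4 / 2 - s * h3

end FirstOrder

section Conjugate

variable {n : ℕ} {φ : EuclideanSpace ℝ (Fin n) → ℝ} {σ : ℝ}

theorem StrongConvexOn.exists_quadratic_lower_bound (hσ : 0 < σ)
    (hφ : StrongConvexOn Set.univ σ φ) :
    ∃ C, ∀ x, σ / 2 * ‖x‖ ^ 2 - C * (‖x‖ + 1) ≤ φ x := by
  have hconv : ConvexOn ℝ Set.univ φ := UniformConvexOn.convexOn hφ fun r => by positivity
  have hcont := hconv.continuousOn isOpen_univ
  obtain ⟨m, hm⟩ := (isCompact_closedBall (0 : EuclideanSpace ℝ (Fin n)) 1).bddBelow_image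
    (hcont.mono (subset_univ _))
  have hm' : ∀ x : EuclideanSpace ℝ (Fin n), ‖x‖ ≤ 1 → m ≤ φ x := fun x hx =>
    hm (mem_image_of_mem φ (by simpa using hx))
  refine ⟨|m| + |φ 0| + σ / 2, fun x => ?_⟩
  have hm1 := neg_abs_le m
  have hp1 := abs_nonneg (φ 0)
  have hm0 := abs_nonneg m
  have hp2 := le_abs_self (φ 0)
  have hx0 := norm_nonneg x
  rcases le_or_gt ‖x‖ 1 with hx | hx
  · have := hm' x hx
    nlinarith [mul_nonneg hm0 hx0, mul_nonneg hp1 hx0, mul_nonneg hσ.le hx0,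
      mul_nonneg hσ.le (mul_nonneg hx0 (sub_nonneg.2 hx))]
  · have hpos : 0 < ‖x‖ := by linarith
    have h1 := hm' (‖x‖⁻¹ • x) (by
      rw [norm_smul, norm_inv, norm_norm, inv_mul_cancel₀ hpos.ne'])
    have h2 := hφ.2 (mem_univ x) (mem_univ 0) (inv_nonneg.2 hx0)
      (sub_nonneg.2 (inv_le_one_of_one_le₀ hx.le)) (by ring)
    simp only [smul_zero, add_zero, sub_zero, smul_eq_mul] at h2
    have h3 := mul_le_mul_of_nonneg_left (h1.trans h2) hx0
    have h4 : ‖x‖ * (‖x‖⁻¹ * φ x + (1 - ‖x‖⁻¹) * φ 0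
        - ‖x‖⁻¹ * (1 - ‖x‖⁻¹) * (σ / 2 * ‖x‖ ^ 2))
        = φ x + (‖x‖ - 1) * φ 0 - (‖x‖ - 1) * (σ / 2 * ‖x‖) := by
      field_simp
    rw [h4] at h3
    nlinarith [mul_le_mul_of_nonneg_left hm1 hx0,
      mul_le_mul_of_nonneg_left hp2 (sub_nonneg.2 hx.le)]

theorem StrongConvexOn.bddAbove_range_inner_sub (hσ : 0 < σ)
    (hφ : StrongConvexOn Set.univ σ φ) (z : EuclideanSpace ℝ (Fin n)) :
    BddAbove (range fun x => ⟪z, x⟫ - φ x) := by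
  obtain ⟨C, hC⟩ := hφ.exists_quadratic_lower_bound hσ
  refine ⟨(‖z‖ + C) ^ 2 / (2 * σ) + C, ?_⟩
  rintro _ ⟨x, rfl⟩
  have h1 := hC x
  have h2 := real_inner_le_norm z x
  have h3 : 0 ≤ (σ * ‖x‖ - (‖z‖ + C)) ^ 2 / (2 * σ) := by positivity
  have h4 : (σ * ‖x‖ - (‖z‖ + C)) ^ 2 / (2 * σ)
      = σ / 2 * ‖x‖ ^ 2 - (‖z‖ + C) * ‖x‖ + (‖z‖ + C) ^ 2 / (2 * σ) := by
    field_simp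
    ring
  change ⟪z, x⟫ - φ x ≤ _
  linarith

theorem StrongConvexOn.inner_sub_le_fenchelConj (hσ : 0 < σ)
    (hφ : StrongConvexOn Set.univ σ φ) (z x : EuclideanSpace ℝ (Fin n)) :
    ⟪z, x⟫ - φ x ≤ fenchelConj φ z :=
  le_ciSup (hφ.bddAbove_range_inner_sub hσ z) x

theorem StrongConvexOn.convexOn_fenchelConj (hσ : 0 < σ)
    (hφ : StrongConvexOn Set.univ σ φ) : ConvexOn ℝ Set.univ (fenchelConj φ) := by
  refine ⟨convex_univ, fun z _ w _ a b ha hb hab => ciSup_le fun x => ?_⟩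
  have h1 := mul_le_mul_of_nonneg_left (hφ.inner_sub_le_fenchelConj hσ z x) ha
  have h2 := mul_le_mul_of_nonneg_left (hφ.inner_sub_le_fenchelConj hσ w x) hb
  rw [inner_add_left, real_inner_smul_left, real_inner_smul_left, smul_eq_mul, smul_eq_mul]
  linear_combination h1 + h2 + φ x * hab

/-- The conjugate of a strongly convex function is semiconcave. -/
theorem StrongConvexOn.le_fenchelConj_convex_combination (hσ : 0 < σ)
    (hφ : StrongConvexOn Set.univ σ φ) (z w : EuclideanSpace ℝ (Fin n)) {a b : ℝ}
    (ha : 0 < a) (hb : 0 < b) (hab : a + b = 1) :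
    a * fenchelConj φ z + b * fenchelConj φ w
      ≤ fenchelConj φ (a • z + b • w) + a * b * (‖z - w‖ ^ 2 / (2 * σ)) := by
  have key : ∀ x y : EuclideanSpace ℝ (Fin n), a * (⟪z, x⟫ - φ x) + b * (⟪w, y⟫ - φ y)
      ≤ fenchelConj φ (a • z + b • w) + a * b * (‖z - w‖ ^ 2 / (2 * σ)) := fun x y => by
    have h1 := hφ.inner_sub_le_fenchelConj hσ (a • z + b • w) (a • x + b • y)
    have h2 := hφ.2 (mem_univ x) (mem_univ y) ha.le hb.le hab
    have h3 := real_inner_le_norm (z - w) (x - y)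
    have h4 : 0 ≤ (σ * ‖x - y‖ - ‖z - w‖) ^ 2 / (2 * σ) := by positivity
    have h5 : (σ * ‖x - y‖ - ‖z - w‖) ^ 2 / (2 * σ)
        = σ / 2 * ‖x - y‖ ^ 2 - ‖z - w‖ * ‖x - y‖ + ‖z - w‖ ^ 2 / (2 * σ) := by
      field_simp
      ring
    rw [h5] at h4
    have h6 := mul_le_mul_of_nonneg_left (h3.trans (by linarith : _ ≤
      σ / 2 * ‖x - y‖ ^ 2 + ‖z - w‖ ^ 2 / (2 * σ))) (mul_nonneg ha.le hb.le)
    simp only [inner_add_left, inner_add_right, inner_sub_left, inner_sub_right,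
      real_inner_smul_left, real_inner_smul_right, smul_eq_mul] at h1 h2 h6
    obtain rfl : b = 1 - a := by linarith
    linear_combination h1 + h2 + h6
  have hx : ∀ y, a * fenchelConj φ z + b * (⟪w, y⟫ - φ y)
      ≤ fenchelConj φ (a • z + b • w) + a * b * (‖z - w‖ ^ 2 / (2 * σ)) := fun y => by
    rw [← le_sub_iff_add_le, ← le_div_iff₀' ha]
    exact ciSup_le fun x => by
      rw [le_div_iff₀' ha, le_sub_iff_add_le]
      exact key x y
  rw [← le_sub_iff_add_le', ← le_div_iff₀' hb]
  exact ciSup_le fun y => by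
    rw [le_div_iff₀' hb, le_sub_iff_add_le']
    exact hx y

/-- The conjugate of a `σ`-strongly convex function is `1 / σ`-smooth. -/
theorem StrongConvexOn.fenchelConj_le_add_inner_add_sq (hσ : 0 < σ)
    (hφ : StrongConvexOn Set.univ σ φ) {g z : EuclideanSpace ℝ (Fin n)}
    (hg : HasGradientAt (fenchelConj φ) g z) (w : EuclideanSpace ℝ (Fin n)) :
    fenchelConj φ w ≤ fenchelConj φ z + ⟪g, w - z⟫ + ‖w - z‖ ^ 2 / (2 * σ) := by
  have hneg : HasGradientAt (fun u => -fenchelConj φ u) (-g) z := by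
    rw [hasGradientAt_iff_hasFDerivAt, map_neg]
    exact hg.hasFDerivAt.neg
  have h := hneg.inner_le_of_convex_defect (y := w) (C := ‖w - z‖ ^ 2 / (2 * σ))
    fun t ht0 ht1 => by
      have h := hφ.le_fenchelConj_convex_combination hσ z w (sub_pos.2 ht1) ht0 (by ring)
      rw [show z + t • (w - z) = (1 - t) • z + t • w by module]
      rw [norm_sub_rev] at h
      linarith
  rw [inner_neg_left] at h
  linarith

end Conjugate

/-- If `∑ (i + 1)² G i` converges, then the running minimum of `G` is `o(1 / k³)`. -/
theorem tendsto_cube_mul_sInf_of_summable {G : ℕ → ℝ} (hG : ∀ i, 0 ≤ G i)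
    (hsum : Summable fun i : ℕ => ((i : ℝ) + 1) ^ 2 * G i) :
    Tendsto (fun k : ℕ => (k : ℝ) ^ 3 * sInf (G '' {i : ℕ | i ≤ k})) atTop (𝓝 0) := by
  have hbdd : ∀ k : ℕ, BddBelow (G '' {i : ℕ | i ≤ k}) := fun k =>
    ⟨0, by rintro _ ⟨i, -, rfl⟩; exact hG i⟩
  have hnn : ∀ k : ℕ, 0 ≤ sInf (G '' {i : ℕ | i ≤ k}) := fun k =>
    Real.sInf_nonneg (by rintro _ ⟨i, -, rfl⟩; exact hG i)
  have hS := hsum.hasSum.tendsto_sum_nat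
  have hhalf : Tendsto (fun k : ℕ => k / 2) atTop atTop :=
    Nat.tendsto_div_const_atTop two_ne_zero
  have hlim := (hS.sub (hS.comp hhalf)).const_mul 8
  rw [sub_self, mul_zero] at hlim
  refine squeeze_zero (fun k => mul_nonneg (by positivity) (hnn k)) (fun k => ?_) hlim
  rw [Function.comp_apply, ← Finset.sum_Ico_eq_sub _ (Nat.div_le_self k 2)]
  have hterm : ∀ i ∈ Finset.Ico (k / 2) k,
      ((k : ℝ) / 2) ^ 2 * sInf (G '' {i : ℕ | i ≤ k}) ≤ ((i : ℝ) + 1) ^ 2 * G i := fun i hi => by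
    rw [Finset.mem_Ico] at hi
    have hik : (k : ℝ) / 2 ≤ (i : ℝ) + 1 := by
      have : k ≤ 2 * (i + 1) := by omega
      have : (k : ℝ) ≤ 2 * ((i : ℝ) + 1) := by exact_mod_cast this
      linarith
    have hle : sInf (G '' {i : ℕ | i ≤ k}) ≤ G i := csInf_le (hbdd k) ⟨i, hi.2.le, rfl⟩
    have := hnn k
    gcongr
  have hcard := Finset.card_nsmul_le_sum _ _ _ hterm
  rw [Nat.card_Ico, nsmul_eq_mul] at hcard
  have hk : (k : ℝ) / 2 ≤ ((k - k / 2 : ℕ) : ℝ) := by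
    have : k ≤ 2 * (k - k / 2) := by omega
    have : (k : ℝ) ≤ 2 * ((k - k / 2 : ℕ) : ℝ) := by exact_mod_cast this
    linarith
  have h := mul_le_mul_of_nonneg_right hk
    (mul_nonneg (sq_nonneg ((k : ℝ) / 2)) (hnn k))
  linarith


/-- For unconstrained accelerated mirror descent with `0 < s ≤ 1/L`,
`min_{0 ≤ i ≤ k} ‖∇f(x_i)‖² = o(1/k³)` as `k → ∞`. -/
theorem accelerated_mirror_descent_gradient_rate
{n : ℕ} (f φ : EuclideanSpace ℝ (Fin n) → ℝ)
    (f' gφs : EuclideanSpace ℝ (Fin n) → EuclideanSpace ℝ (Fin n))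
    (σ L s : ℝ) (hσ : 0 < σ)
    -- f is convex and differentiable with L-Lipschitz gradient
    (hfconv : ConvexOn ℝ Set.univ f)
    (hfd : ∀ x, HasGradientAt f (f' x) x)
    (hfL : ∀ x y, ‖f' x - f' y‖ ≤ L * ‖x - y‖)
    -- φ is σ-strongly convex
    (hφsc : StrongConvexOn Set.univ σ φ)
    -- φ* is differentiable with gradient gφs
    (hgφs : ∀ z, HasGradientAt (fenchelConj φ) (gφs z) z)
    -- the unconstrained accelerated mirror descent iteration
    (x z : ℕ → EuclideanSpace ℝ (Fin n))
    (hz : ∀ k : ℕ, z (k + 1) = z k - ((((k : ℝ) + 1) * σ * s) / 2) • f' (x k))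
    (hxz : ∀ k : ℕ, gφs (z (k + 1)) =
      (1 / 2 : ℝ) • ((((k : ℝ) + 3)) • x (k + 1) - (((k : ℝ) + 1)) • x k +
        ((((k : ℝ) + 1)) * s) • f' (x k)))
    -- x* is a global minimizer of f and ∇φ*(z*) = x*
    (xs zs : EuclideanSpace ℝ (Fin n))
    (hxs : ∀ w, f xs ≤ f w) (hzs : gφs zs = xs)
    (hs : 0 < s) (hsL : s ≤ 1 / L) :
    Tendsto
      (fun k : ℕ => (k : ℝ) ^ 3 * sInf ((fun i => ‖f' (x i)‖ ^ 2) '' {i : ℕ | i ≤ k}))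
      atTop (𝓝 0) := by
  have hL : 0 < L := one_div_pos.1 (hs.trans_le hsL)
  have hLs : L * s ≤ 1 := by
    rw [le_div_iff₀ hL] at hsL
    linarith
  have hmin : f' xs = 0 := by
    have h := (isMinOn_univ_iff.2 hxs).isLocalMin univ_mem |>.hasFDerivAt_eq_zero
      (hfd xs).hasFDerivAt
    simpa using h
  have hco := hfconv.add_inner_add_sq_le_of_lipschitz_gradient hfd hfL hs.le hLs
  -- the Lyapunov function
  let V : ℕ → ℝ := fun k => fenchelConj φ (z k) - fenchelConj φ zs - ⟪xs, z k - zs⟫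
  have hV : ∀ k, 0 ≤ V k := fun k => by
    have h := (hφsc.convexOn_fenchelConj hσ).add_inner_le_of_hasGradientAt (hgφs zs) (z k)
    rw [hzs] at h
    simp only [V]
    linarith
  let U : ℕ → ℝ := fun j =>
    4 / (σ * s) * V (j + 1) + ((j : ℝ) + 1) * ((j : ℝ) + 2) * (f (x j) - f xs)
  have hU : ∀ j, 0 ≤ U j := fun j => by
    have h1 := hV (j + 1)
    have h2 := sub_nonneg.2 (hxs (x j))
    simp only [U]
    positivity
  have hstep : ∀ j : ℕ,
      U (j + 1) + s / 2 * (((j : ℝ) + 1) * ((j : ℝ) + 2) * ‖f' (x j)‖ ^ 2) ≤ U j := fun j => by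
    have hsm := hφsc.fenchelConj_le_add_inner_add_sq hσ (hgφs (z (j + 1))) (z (j + 1 + 1))
    have hdz : z (j + 1 + 1) - z (j + 1) = -(((((j : ℝ) + 2) * σ * s) / 2) • f' (x (j + 1))) := by
      rw [hz (j + 1)]
      push_cast
      module
    have hVd : V (j + 1 + 1) - V (j + 1) ≤ ⟪gφs (z (j + 1)) - xs, z (j + 1 + 1) - z (j + 1)⟫
        + ‖z (j + 1 + 1) - z (j + 1)‖ ^ 2 / (2 * σ) := by
      simp only [V, inner_sub_left, inner_sub_right] at hsm ⊢
      linarith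
    have hsq : ‖z (j + 1 + 1) - z (j + 1)‖ ^ 2 / (2 * σ)
        = σ * s / 4 * (s * ((j : ℝ) + 2) ^ 2 / 2 * ‖f' (x (j + 1))‖ ^ 2) := by
      rw [hdz, norm_neg, norm_smul, mul_pow, Real.norm_eq_abs, sq_abs]
      field_simp
      ring
    have hin : ⟪gφs (z (j + 1)) - xs, z (j + 1 + 1) - z (j + 1)⟫
        = -(σ * s / 4 * (((j : ℝ) + 2) * (2 * ⟪f' (x (j + 1)), x (j + 1) - xs⟫
          + ((j : ℝ) + 1) * (⟪f' (x (j + 1)), x (j + 1) - x j⟫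
            + s * ⟪f' (x (j + 1)), f' (x j)⟫)))) := by
      rw [hdz, hxz j, real_inner_comm]
      simp only [inner_neg_left, inner_add_right, inner_sub_right, real_inner_smul_left,
        real_inner_smul_right]
      ring
    rw [hsq, hin] at hVd
    have hW : 4 / (σ * s) * V (j + 1 + 1) - 4 / (σ * s) * V (j + 1) ≤
        s * ((j : ℝ) + 2) ^ 2 / 2 * ‖f' (x (j + 1))‖ ^ 2
        - ((j : ℝ) + 2) * (2 * ⟪f' (x (j + 1)), x (j + 1) - xs⟫
          + ((j : ℝ) + 1) * (⟪f' (x (j + 1)), x (j + 1) - x j⟫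
            + s * ⟪f' (x (j + 1)), f' (x j)⟫)) := by
      rw [← mul_sub, div_mul_eq_mul_div, div_le_iff₀ (mul_pos hσ hs)]
      linarith
    have h1 := hco (x (j + 1)) xs
    have h2 := hco (x (j + 1)) (x j)
    rw [hmin, sub_zero, ← neg_sub, inner_neg_right] at h1
    rw [norm_sub_sq_real, ← neg_sub, inner_neg_right] at h2
    have hj : (0 : ℝ) ≤ (j : ℝ) + 2 := by positivity
    have hj' : (0 : ℝ) ≤ ((j : ℝ) + 2) * ((j : ℝ) + 1) := by positivity
    have h3 := mul_le_mul_of_nonneg_left h1 hj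
    have h4 := mul_le_mul_of_nonneg_left h2 hj'
    have h5 : 0 ≤ s / 2 * ((j : ℝ) + 2) * ‖f' (x (j + 1))‖ ^ 2 := by positivity
    simp only [U]
    push_cast
    linear_combination hW + 2 * h3 + h4 + h5
  have hpart : ∀ N : ℕ,
      U N + s / 2 * ∑ j ∈ Finset.range N, ((j : ℝ) + 1) * ((j : ℝ) + 2) * ‖f' (x j)‖ ^ 2
        ≤ U 0 := fun N => by
    induction N with
    | zero => simp
    | succ N ih =>
      rw [Finset.sum_range_succ]
      linarith [hstep N]
  have hsum : Summable fun j : ℕ => ((j : ℝ) + 1) * ((j : ℝ) + 2) * ‖f' (x j)‖ ^ 2 :=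
    summable_of_sum_range_le (c := U 0 / (s / 2)) (fun j => by positivity) fun N => by
      rw [le_div_iff₀' (by positivity)]
      linarith [hpart N, hU N]
  refine tendsto_cube_mul_sInf_of_summable (fun i => by positivity)
    (hsum.of_nonneg_of_le (fun i => by positivity) fun i => ?_)
  rw [sq]
  gcongr
  norm_num
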